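/- Let m, n ∈ ℕ, let u ∈ W^{m,1}_loc(ℝⁿ), and let all derivatives D^α u for |α| ≤ m be defined at every point x ∈ ℝⁿ by D^α u(x) = limsup_{r→0} of the average of D^α u over the ball B(x,r). Then there is a constant C depending only on n and m such that for all x, y ∈ ℝⁿ with x ≠ y, |u(y) − T_x^{m−1}u(y)| ≤ C |x − y|^m (ℳ|∇^m u|(x) + ℳ|∇^m u|(y)), where T_x^{m−1}u(y) = Σ_{|α|≤m−1} D^α u(x) (y−x)^α/α! is the Taylor polynomial of order m−1 of u at x, |∇^m u| is the Euclidean norm of the vector of all m-th order partial derivatives, and ℳg(x) = sup_{r>0} of the average of |g| over B(x,r) is the Hardy–Littlewood maximal function (with the convention that the inequality holds trivially whenever a quantity on the left is infinite, in which case the right-hand side is also infinite). -/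

import Mathlib

open MeasureTheory Metric Set Filter
open scoped ENNReal

/-- `g` is the weak `i`-th partial derivative of `f` on `ℝⁿ`. -/
def HasWeakPartialDeriv {n : ℕ} (f g : EuclideanSpace ℝ (Fin n) → ℝ) (i : Fin n) : Prop :=
  ∀ φ : EuclideanSpace ℝ (Fin n) → ℝ, ContDiff ℝ (⊤ : ℕ∞) φ → HasCompactSupport φ →
    ∫ x, f x * fderiv ℝ φ x (EuclideanSpace.single i 1) = - ∫ x, g x * φ x

/-- `D` is a family of weak partial derivatives of `u`, indexed by multi-indices
`α : Fin n → ℕ`, compatible up to order `m`. -/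
def WeakDerivFamily {n : ℕ} (m : ℕ) (u : EuclideanSpace ℝ (Fin n) → ℝ)
    (D : (Fin n → ℕ) → EuclideanSpace ℝ (Fin n) → ℝ) : Prop :=
  D 0 = u ∧
  ∀ (α : Fin n → ℕ) (i : Fin n), (∑ j, α j) < m →
    HasWeakPartialDeriv (D α) (D (α + Pi.single i 1)) i

/-- The precise representative `x ↦ limsup_{r → 0⁺} ⨍_{B(x,r)} f`. -/
noncomputable def rep {n : ℕ} (f : EuclideanSpace ℝ (Fin n) → ℝ)
    (x : EuclideanSpace ℝ (Fin n)) : ℝ :=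
  Filter.limsup (fun r : ℝ => ⨍ y in ball x r, f y) (nhdsWithin 0 (Set.Ioi 0))

/-- The Hardy–Littlewood maximal function, with values in `ℝ≥0∞`. -/
noncomputable def maxFn {n : ℕ} (g : EuclideanSpace ℝ (Fin n) → ℝ)
    (x : EuclideanSpace ℝ (Fin n)) : ℝ≥0∞ :=
  ⨆ (r : ℝ) (_ : 0 < r), (volume (ball x r))⁻¹ * ∫⁻ y in ball x r, ‖g y‖₊

/-- `|∇^m u|`: the Euclidean norm of the vector of all `m`-th order weak partial
derivatives from the family `D`. -/
noncomputable def gradmNorm {n : ℕ} (m : ℕ)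
    (D : (Fin n → ℕ) → EuclideanSpace ℝ (Fin n) → ℝ)
    (x : EuclideanSpace ℝ (Fin n)) : ℝ :=
  Real.sqrt (∑' α : {α : Fin n → ℕ // (∑ j, α j) = m}, (D α.1 x) ^ 2)

open Topology Convolution
open scoped NNReal

/-- The derivative of a mollification is the mollification of the weak derivative. -/
theorem HasWeakPartialDeriv.fderiv_convolution {n : ℕ} {f g : EuclideanSpace ℝ (Fin n) → ℝ}
    {i : Fin n} (h : HasWeakPartialDeriv f g i) (hf : LocallyIntegrable f volume)
    (φ : ContDiffBump (0 : EuclideanSpace ℝ (Fin n))) (p : EuclideanSpace ℝ (Fin n)) :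
    fderiv ℝ (φ.normed volume ⋆[ContinuousLinearMap.lsmul ℝ ℝ, volume] f) p
        (EuclideanSpace.single i 1)
      = (φ.normed volume ⋆[ContinuousLinearMap.lsmul ℝ ℝ, volume] g) p := by
  have hφ1 : ContDiff ℝ 1 (φ.normed volume) := φ.contDiff_normed (n := 1)
  have hcs : HasCompactSupport (φ.normed volume) := φ.hasCompactSupport_normed
  rw [(hcs.hasFDerivAt_convolution_left _ hφ1 hf p).fderiv]
  have hconv := (hcs.fderiv ℝ).convolutionExists_left
    ((ContinuousLinearMap.lsmul ℝ ℝ : ℝ →L[ℝ] ℝ →L[ℝ] ℝ).precompL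
      (EuclideanSpace ℝ (Fin n))) (hφ1.continuous_fderiv one_ne_zero) hf p
  have hconv' : Integrable (fun t => ((ContinuousLinearMap.lsmul ℝ ℝ : ℝ →L[ℝ] ℝ →L[ℝ] ℝ).precompL
      (EuclideanSpace ℝ (Fin n))) (fderiv ℝ (φ.normed volume) (p - t)) (f t)) volume := by
    have := hconv.integrable_swap
    simpa using this
  rw [convolution_eq_swap, convolution_eq_swap,
    ContinuousLinearMap.integral_apply hconv']
  have hφ2 : ContDiff ℝ (⊤ : ℕ∞) (φ.normed volume) := φ.contDiff_normed (n := ⊤)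
  have key := h (fun t => φ.normed volume (p - t)) (hφ2.comp (contDiff_const.sub contDiff_id))
    (hcs.comp_homeomorph (Homeomorph.subLeft p))
  have hd : ∀ t, fderiv ℝ (fun t => φ.normed volume (p - t)) t (EuclideanSpace.single i 1)
      = - fderiv ℝ (φ.normed volume) (p - t) (EuclideanSpace.single i 1) := by
    intro t
    have := ((hφ1.differentiable one_ne_zero (p - t)).hasFDerivAt.comp t
      ((hasFDerivAt_id t).const_sub p)).fderiv
    simp only [Function.comp_def] at this
    rw [this]
    simp
  simp only [hd, mul_neg, integral_neg, neg_inj] at key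
  simp only [ContinuousLinearMap.precompL_apply, ContinuousLinearMap.lsmul_apply, smul_eq_mul]
  convert key using 2
  · ext t; ring
  · ext t; ring

theorem enorm_sub_le_lintegral_fderiv {E : Type*} [NormedAddCommGroup E] [NormedSpace ℝ E]
    {v : E → ℝ} (hv : ContDiff ℝ 1 v) (x z : E) :
    ‖v z - v x‖ₑ ≤ ∫⁻ t in Ioc (0 : ℝ) 1, ‖fderiv ℝ v (x + t • (z - x)) (z - x)‖ₑ := by
  have hd : ∀ t : ℝ, HasDerivAt (fun t : ℝ => v (x + t • (z - x)))
      (fderiv ℝ v (x + t • (z - x)) (z - x)) t := by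
    intro t
    have h1 : HasDerivAt (fun t : ℝ => x + t • (z - x)) (z - x) t := by
      simpa using ((hasDerivAt_id t).smul_const (z - x)).const_add x
    exact ((hv.differentiable one_ne_zero _).hasFDerivAt).comp_hasDerivAt t h1
  have hc : Continuous fun t : ℝ => fderiv ℝ v (x + t • (z - x)) (z - x) :=
    ((hv.continuous_fderiv one_ne_zero).comp (by fun_prop)).clm_apply continuous_const
  have := intervalIntegral.integral_eq_sub_of_hasDerivAt (a := 0) (b := 1)
    (fun t _ => hd t) (hc.intervalIntegrable _ _)
  simp only [one_smul, zero_smul, add_zero, add_sub_cancel] at this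
  rw [← this, intervalIntegral.integral_of_le zero_le_one]
  exact enorm_integral_le_lintegral_enorm _

theorem setLIntegral_ball_comp_homothety {n : ℕ} (H : EuclideanSpace ℝ (Fin n) → ℝ≥0∞)
    (x : EuclideanSpace ℝ (Fin n)) {t : ℝ} (ht : 0 < t) (s : ℝ) :
    ENNReal.ofReal (t ^ n) * ∫⁻ z in ball x s, H (x + t • (z - x))
      = ∫⁻ z in ball x (t * s), H z := by
  set e : EuclideanSpace ℝ (Fin n) ≃ₜ EuclideanSpace ℝ (Fin n) := 
    ((Homeomorph.subRight x).trans (Homeomorph.smulOfNeZero t ht.ne')).trans (Homeomorph.addLeft x)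
    with he
  have hee : ∀ z, e z = x + t • (z - x) := fun z => rfl
  have hmap : Measure.map e volume = ENNReal.ofReal ((t ^ n)⁻¹) • volume := by
    have h1 : (e : EuclideanSpace ℝ (Fin n) → _) = (fun z => x + z) ∘ (fun z => t • z) ∘ (fun z => z - x) := rfl
    rw [h1, ← Measure.map_map (by fun_prop) (by fun_prop),
      ← Measure.map_map (by fun_prop) (by fun_prop), map_sub_right_eq_self,
      Measure.map_addHaar_smul _ ht.ne', Measure.map_smul, map_add_left_eq_self]
    simp [abs_of_pos ht]
  have hpre : e ⁻¹' (ball x (t * s)) = ball x s := by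
    ext z
    simp only [mem_preimage, hee, mem_ball, dist_eq_norm, add_sub_cancel_left, norm_smul,
      Real.norm_eq_abs, abs_of_pos ht]
    exact mul_lt_mul_iff_right₀ ht
  have h2 : ∫⁻ z in ball x s, H (x + t • (z - x)) 
      = ∫⁻ z in ball x (t * s), H z ∂(Measure.map e volume) := by
    rw [← hpre, e.measurableEmbedding.restrict_map, e.measurableEmbedding.lintegral_map]
    rfl
  rw [h2, hmap, Measure.restrict_smul, lintegral_smul_measure, smul_eq_mul, ← mul_assoc,
    ← ENNReal.ofReal_mul (by positivity), mul_inv_cancel₀ (by positivity)]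
  simp

theorem volume_ball_mul {n : ℕ} (x : EuclideanSpace ℝ (Fin n)) {t : ℝ} (ht : 0 < t) (s : ℝ) :
    volume (ball x (t * s)) = ENNReal.ofReal (t ^ n) * volume (ball x s) := by
  rw [Measure.addHaar_ball_mul_of_pos _ x ht, Measure.addHaar_ball_center _ x, finrank_euclideanSpace_fin]

theorem setLIntegral_normed_bump_le {n : ℕ} (φ : ContDiffBump (0 : EuclideanSpace ℝ (Fin n)))
    (hφ : φ.rOut ≤ 2 * φ.rIn) (x t : EuclideanSpace ℝ (Fin n)) {s : ℝ} (hs : 0 < s) :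
    ∫⁻ p in ball x s, ENNReal.ofReal (φ.normed volume (p - t))
      ≤ (ball x (2 * max s φ.rOut)).indicator
        (fun _ => 2 ^ n * volume (ball x s) / volume (ball x (max s φ.rOut))) t := by
  have hsupp : ∀ p, φ.normed volume (p - t) ≠ 0 → dist p t < φ.rOut := by
    intro p hp
    have : p - t ∈ Function.support (φ.normed volume) := hp
    rw [φ.support_normed_eq] at this
    simpa [dist_eq_norm] using this
  by_cases ht : t ∈ ball x (2 * max s φ.rOut)
  · rw [indicator_of_mem ht]
    rcases le_total φ.rOut s with h | h
    · rw [max_eq_left h, mul_div_assoc, ENNReal.div_self (measure_ball_pos _ _ hs).ne'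
        measure_ball_lt_top.ne]
      calc ∫⁻ p in ball x s, ENNReal.ofReal (φ.normed volume (p - t))
          ≤ ∫⁻ p, ENNReal.ofReal (φ.normed volume (p - t)) := setLIntegral_le_lintegral _ _
        _ = ∫⁻ p, ENNReal.ofReal (φ.normed volume p) :=
            lintegral_sub_right_eq_self (fun p => ENNReal.ofReal (φ.normed volume p)) t
        _ = 1 := by
            rw [← ofReal_integral_eq_lintegral_ofReal φ.integrable_normed
              (Eventually.of_forall fun p => φ.nonneg_normed p), φ.integral_normed]
            simp
        _ ≤ 2 ^ n * 1 := by simp [one_le_pow₀]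
    · rw [max_eq_right h]
      calc ∫⁻ p in ball x s, ENNReal.ofReal (φ.normed volume (p - t))
          ≤ ∫⁻ p in ball x s, 2 ^ n / volume (ball x φ.rOut) := by
            refine lintegral_mono fun p => ?_
            have := φ.normed_le_div_measure_closedBall_rOut volume 2 hφ (p - t)
            rw [finrank_euclideanSpace_fin] at this
            refine (ENNReal.ofReal_le_ofReal this).trans ?_
            have hpos : 0 < volume.real (closedBall (0 : EuclideanSpace ℝ (Fin n)) φ.rOut) :=
              ENNReal.toReal_pos (measure_closedBall_pos _ _ φ.rOut_pos).ne'
                measure_closedBall_lt_top.ne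
            rw [ENNReal.ofReal_div_of_pos hpos, ofReal_measureReal measure_closedBall_lt_top.ne,
              ENNReal.ofReal_pow (by norm_num), ENNReal.ofReal_ofNat,
              Measure.addHaar_ball_center _ x]
            gcongr
            exact ball_subset_closedBall
        _ = 2 ^ n * volume (ball x s) / volume (ball x φ.rOut) := by
            rw [setLIntegral_const, mul_comm, ← mul_div_assoc, mul_comm]
  · rw [indicator_of_notMem ht]
    refine (setLIntegral_congr_fun measurableSet_ball fun p hp => ?_).trans_le
      (lintegral_zero (μ := volume.restrict (ball x s))).le
    by_contra hne
    have h0 : φ.normed volume (p - t) ≠ 0 := fun h => hne (by simp [h])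
    apply ht
    have h1 := hsupp p h0
    have h2 : dist p x < s := hp
    have := dist_triangle_left t x p
    rw [mem_ball]
    linarith [le_max_left s φ.rOut, le_max_right s φ.rOut]

/-- Averages of a mollification over balls centred at `x` are controlled by the averages of the
original function. -/
theorem setLIntegral_ball_mollify_le {n : ℕ} (φ : ContDiffBump (0 : EuclideanSpace ℝ (Fin n)))
    (hφ : φ.rOut ≤ 2 * φ.rIn) {g : EuclideanSpace ℝ (Fin n) → ℝ≥0∞} (hg : AEMeasurable g volume)
    {x : EuclideanSpace ℝ (Fin n)} {R : ℝ} {A : ℝ≥0∞}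
    (hA : ∀ s, 0 < s → s ≤ R → ∫⁻ t in ball x s, g t ≤ A * volume (ball x s))
    {s : ℝ} (hs : 0 < s) (hsR : 2 * s ≤ R) (hφR : 2 * φ.rOut ≤ R) :
    ∫⁻ p in ball x s, ∫⁻ t, ENNReal.ofReal (φ.normed volume (p - t)) * g t
      ≤ 4 ^ n * A * volume (ball x s) := by
  have hρ : 0 < max s φ.rOut := lt_max_of_lt_left hs
  have hmeas : Measurable fun q : EuclideanSpace ℝ (Fin n) × EuclideanSpace ℝ (Fin n) =>
      ENNReal.ofReal (φ.normed volume (q.1 - q.2)) :=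
    ((φ.continuous_normed.comp (continuous_fst.sub continuous_snd)).measurable).ennreal_ofReal
  rw [lintegral_lintegral_swap (hmeas.aemeasurable.mul
    (hg.comp_quasiMeasurePreserving Measure.quasiMeasurePreserving_snd))]
  have hvol : volume (ball x (max s φ.rOut)) ≠ 0 := (measure_ball_pos _ _ hρ).ne'
  have hvol' : volume (ball x (max s φ.rOut)) ≠ ∞ := measure_ball_lt_top.ne
  calc ∫⁻ t, ∫⁻ p in ball x s, ENNReal.ofReal (φ.normed volume (p - t)) * g t
      = ∫⁻ t, (∫⁻ p in ball x s, ENNReal.ofReal (φ.normed volume (p - t))) * g t := by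
        refine lintegral_congr fun t => ?_
        have hm : Measurable fun p => ENNReal.ofReal (φ.normed volume (p - t)) :=
          ((φ.continuous_normed.comp (continuous_id.sub continuous_const)).measurable).ennreal_ofReal
        rw [lintegral_mul_const _ hm]
    _ ≤ ∫⁻ t, (ball x (2 * max s φ.rOut)).indicator
        (fun t => 2 ^ n * volume (ball x s) / volume (ball x (max s φ.rOut)) * g t) t := by
        refine lintegral_mono fun t => ?_
        refine (mul_le_mul_left (setLIntegral_normed_bump_le φ hφ x t hs) (g t)).trans ?_
        by_cases ht : t ∈ ball x (2 * max s φ.rOut) <;> simp [ht]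
    _ = 2 ^ n * volume (ball x s) / volume (ball x (max s φ.rOut)) *
        ∫⁻ t in ball x (2 * max s φ.rOut), g t := by
        rw [lintegral_indicator measurableSet_ball, lintegral_const_mul'' _ hg.restrict]
    _ ≤ 2 ^ n * volume (ball x s) / volume (ball x (max s φ.rOut)) *
        (A * (2 ^ n * volume (ball x (max s φ.rOut)))) := by
        have h1 := hA (2 * max s φ.rOut) (by positivity)
          (by rcases max_choice s φ.rOut with h | h <;> rw [h] <;> assumption)
        rw [volume_ball_mul x two_pos, ENNReal.ofReal_pow two_pos.le, ENNReal.ofReal_ofNat] at h1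
        gcongr
    _ = 4 ^ n * A * volume (ball x s) *
        (volume (ball x (max s φ.rOut)) / volume (ball x (max s φ.rOut))) := by
        rw [show (4 : ℝ≥0∞) = 2 * 2 by norm_num, mul_pow]
        simp only [div_eq_mul_inv]
        ring
    _ = 4 ^ n * A * volume (ball x s) := by rw [ENNReal.div_self hvol hvol', mul_one]

theorem enorm_normed_convolution_le {n : ℕ} (φ : ContDiffBump (0 : EuclideanSpace ℝ (Fin n)))
    (g : EuclideanSpace ℝ (Fin n) → ℝ) (p : EuclideanSpace ℝ (Fin n)) :
    ‖(φ.normed volume ⋆[ContinuousLinearMap.lsmul ℝ ℝ, volume] g) p‖ₑ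
      ≤ ∫⁻ t, ENNReal.ofReal (φ.normed volume (p - t)) * ‖g t‖ₑ := by
  rw [convolution_eq_swap]
  refine (enorm_integral_le_lintegral_enorm _).trans (lintegral_mono fun t => ?_)
  rw [ContinuousLinearMap.lsmul_apply, smul_eq_mul, enorm_mul,
    Real.enorm_of_nonneg (φ.nonneg_normed _)]

theorem setLIntegral_ball_enorm_sub_center_le {n : ℕ} {v : EuclideanSpace ℝ (Fin n) → ℝ}
    (hv : ContDiff ℝ 1 v) {H : EuclideanSpace ℝ (Fin n) → ℝ≥0∞} (hH : Measurable H)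
    (hvH : ∀ p w, ‖fderiv ℝ v p w‖ₑ ≤ ‖w‖ₑ * H p)
    {x : EuclideanSpace ℝ (Fin n)} {R : ℝ} {B : ℝ≥0∞}
    (hB : ∀ s, 0 < s → s ≤ R → ∫⁻ p in ball x s, H p ≤ B * volume (ball x s))
    {s : ℝ} (hs : 0 < s) (hsR : s ≤ R) :
    ∫⁻ z in ball x s, ‖v z - v x‖ₑ ≤ ENNReal.ofReal s * B * volume (ball x s) := by
  have hm : Measurable fun q : EuclideanSpace ℝ (Fin n) × ℝ => H (x + q.2 • (q.1 - x)) :=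
    hH.comp (by fun_prop)
  calc ∫⁻ z in ball x s, ‖v z - v x‖ₑ
      ≤ ∫⁻ z in ball x s, ENNReal.ofReal s * ∫⁻ t in Ioc (0 : ℝ) 1, H (x + t • (z - x)) := by
        refine setLIntegral_mono' measurableSet_ball fun z hz => ?_
        refine (enorm_sub_le_lintegral_fderiv hv x z).trans ?_
        rw [← lintegral_const_mul' _ _ ENNReal.ofReal_ne_top]
        refine lintegral_mono fun t => (hvH _ _).trans ?_
        gcongr
        rw [← ofReal_norm]
        exact ENNReal.ofReal_le_ofReal (by simpa [dist_eq_norm] using (mem_ball.1 hz).le)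
    _ = ENNReal.ofReal s * ∫⁻ t in Ioc (0 : ℝ) 1, ∫⁻ z in ball x s, H (x + t • (z - x)) := by
        rw [lintegral_const_mul' _ _ ENNReal.ofReal_ne_top,
          lintegral_lintegral_swap hm.aemeasurable]
    _ ≤ ENNReal.ofReal s * ∫⁻ _ in Ioc (0 : ℝ) 1, B * volume (ball x s) := by
        gcongr ENNReal.ofReal s * ?_
        refine setLIntegral_mono' (measurableSet_Ioc (a := (0 : ℝ)) (b := 1)) fun t ht => ?_
        have h1 := setLIntegral_ball_comp_homothety H x ht.1 s
        have h2 := hB (t * s) (mul_pos ht.1 hs)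
          (by nlinarith [ht.2])
        have ht0 : ENNReal.ofReal (t ^ n) ≠ 0 := by
          exact (ENNReal.ofReal_pos.2 (pow_pos ht.1 n)).ne'
        rw [← h1, volume_ball_mul x ht.1, mul_left_comm] at h2
        exact (ENNReal.mul_le_mul_iff_right ht0 ENNReal.ofReal_ne_top).1 h2
    _ = ENNReal.ofReal s * B * volume (ball x s) := by
        simp [mul_assoc]

theorem enorm_apply_le_of_single {n : ℕ} (T : EuclideanSpace ℝ (Fin n) →L[ℝ] ℝ)
    (w : EuclideanSpace ℝ (Fin n)) :
    ‖T w‖ₑ ≤ ‖w‖ₑ * ∑ i, ‖T (EuclideanSpace.single i 1)‖ₑ := by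
  have h1 : T w = ∑ i, w i * T (EuclideanSpace.single i 1) := by
    conv_lhs => rw [← (EuclideanSpace.basisFun (Fin n) ℝ).sum_repr w]
    simp
  rw [h1, Finset.mul_sum]
  refine (enorm_sum_le _ _).trans (Finset.sum_le_sum fun i _ => ?_)
  rw [enorm_mul]
  gcongr
  rw [← ofReal_norm, ← ofReal_norm]
  exact ENNReal.ofReal_le_ofReal (PiLp.norm_apply_le w i)

/-- If the averages of the weak gradient of `v` over balls centred at `x` are bounded by `A`, then
`v` has a Lebesgue value at `x`, attained at rate `s * A`. -/
theorem exists_setLIntegral_enorm_sub_le {n : ℕ} {v : EuclideanSpace ℝ (Fin n) → ℝ}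
    {G : Fin n → EuclideanSpace ℝ (Fin n) → ℝ} (hv : LocallyIntegrable v volume)
    (hG : ∀ i, LocallyIntegrable (G i) volume) (hvG : ∀ i, HasWeakPartialDeriv v (G i) i)
    {x : EuclideanSpace ℝ (Fin n)} {R : ℝ} (hR : 0 < R) {A : ℝ≥0∞} (hAtop : A ≠ ∞)
    (hA : ∀ s, 0 < s → s ≤ R →
      ∫⁻ t in ball x s, ∑ i, ‖G i t‖ₑ ≤ A * volume (ball x s)) :
    ∃ L : ℝ, ∀ s, 0 < s → 2 * s ≤ R →
      ∫⁻ z in ball x s, ‖v z - L‖ₑ ≤ ENNReal.ofReal s * (4 ^ n * A) * volume (ball x s) := by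
  have hGm : ∀ i, AEMeasurable (fun t => ‖G i t‖ₑ) volume := fun i =>
    (hG i).aestronglyMeasurable.enorm
  let φ : ℕ → ContDiffBump (0 : EuclideanSpace ℝ (Fin n)) := fun k =>
    { rIn := R / (4 * (k + 1))
      rOut := R / (2 * (k + 1))
      rIn_pos := by positivity
      rIn_lt_rOut := by
        apply div_lt_div_of_pos_left hR (by positivity)
        have : (0 : ℝ) ≤ k := k.cast_nonneg
        linarith }
  have hφ2 : ∀ k, (φ k).rOut ≤ 2 * (φ k).rIn := fun k => by
    change R / (2 * (k + 1)) ≤ 2 * (R / (4 * (k + 1)))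
    apply le_of_eq
    field_simp
    norm_num
  have hφR : ∀ k, 2 * (φ k).rOut ≤ R := fun k => by
    change 2 * (R / (2 * (k + 1))) ≤ R
    have h1 : 2 * (R / (2 * ((k : ℝ) + 1))) = R / (k + 1) := by field_simp
    rw [h1]
    exact div_le_self hR.le (by simp)
  have hφ0 : Tendsto (fun k => (φ k).rOut) atTop (𝓝 0) := by
    have h1 : (fun k => (φ k).rOut) = fun k : ℕ => (R / 2) * (1 / ((k : ℝ) + 1)) := by
      ext k
      change R / (2 * (k + 1)) = _
      field_simp
    rw [h1]
    simpa using tendsto_one_div_add_atTop_nhds_zero_nat.const_mul (R / 2)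
  set V : ℕ → EuclideanSpace ℝ (Fin n) → ℝ := fun k =>
    (φ k).normed volume ⋆[ContinuousLinearMap.lsmul ℝ ℝ, volume] v with hV
  have hVc : ∀ k, ContDiff ℝ 1 (V k) := fun k =>
    (φ k).hasCompactSupport_normed.contDiff_convolution_left _ ((φ k).contDiff_normed (n := 1)) hv
  have hest : ∀ k s, 0 < s → 2 * s ≤ R → ∫⁻ z in ball x s, ‖V k z - V k x‖ₑ
      ≤ ENNReal.ofReal s * (4 ^ n * A) * volume (ball x s) := by
    intro k s hs hsR
    refine setLIntegral_ball_enorm_sub_center_le (R := R / 2) (hVc k)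
      (H := fun p => ∑ i, ‖((φ k).normed volume
        ⋆[ContinuousLinearMap.lsmul ℝ ℝ, volume] G i) p‖ₑ) ?_ ?_ ?_ hs (by linarith)
    · refine Finset.measurable_sum _ fun i _ => ?_
      exact ((φ k).hasCompactSupport_normed.continuous_convolution_left _
        (φ k).continuous_normed (hG i)).measurable.enorm
    · intro p w
      refine (enorm_apply_le_of_single _ w).trans_eq ?_
      simp only [hV, (hvG _).fderiv_convolution hv]
    · intro r hr hrR
      refine le_trans (lintegral_mono fun p => ?_)
        (setLIntegral_ball_mollify_le (φ k) (hφ2 k)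
          (Finset.aemeasurable_fun_sum Finset.univ fun i _ => hGm i) hA hr (by linarith) (hφR k))
      simp only [Finset.mul_sum]
      rw [lintegral_finsetSum']
      · exact Finset.sum_le_sum fun i _ => enorm_normed_convolution_le (φ k) (G i) p
      · intro i _
        refine AEMeasurable.mul ?_ (hGm i)
        exact (((φ k).continuous_normed.comp
          (continuous_const.sub continuous_id)).measurable).ennreal_ofReal.aemeasurable
  have hae : ∀ᵐ z, Tendsto (fun k => V k z) atTop (𝓝 (v z)) :=
    ContDiffBump.ae_convolution_tendsto_right_of_locallyIntegrable hφ0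
      (Eventually.of_forall hφ2) hv
  have hmeas : ∀ k, Measurable fun z => ‖V k z - V k x‖ₑ := fun k =>
    ((hVc k).continuous.sub continuous_const).measurable.enorm
  obtain ⟨z, hz, hzlim⟩ : ∃ z, Tendsto (fun k => V k z) atTop (𝓝 (v z)) ∧
      liminf (fun k => ‖V k z - V k x‖ₑ) atTop < ∞ := by
    have h1 : ∫⁻ z in ball x (R / 2), liminf (fun k => ‖V k z - V k x‖ₑ) atTop ≠ ∞ := by
      refine ne_top_of_le_ne_top ?_ ((lintegral_liminf_le hmeas).trans
        (liminf_le_of_le (a := ENNReal.ofReal (R / 2) * (4 ^ n * A) * volume (ball x (R / 2)))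
          (by isBoundedDefault) fun b hb => ?_))
      · exact ENNReal.mul_ne_top (ENNReal.mul_ne_top ENNReal.ofReal_ne_top
          (ENNReal.mul_ne_top (by simp) hAtop)) measure_ball_lt_top.ne
      · obtain ⟨k, hk⟩ := hb.exists
        exact hk.trans (hest k _ (by positivity) (by linarith))
    have h2 := ae_lt_top' (Measurable.liminf hmeas).aemeasurable h1
    have : NeBot (ae (volume.restrict (ball x (R / 2)))) := by
      rw [ae_neBot, Ne, Measure.restrict_eq_zero]
      exact (measure_ball_pos _ _ (by positivity)).ne'
    exact ((ae_restrict_of_ae hae).and h2).exists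
  obtain ⟨K, hK⟩ := exists_between hzlim
  have hfreq : ∃ᶠ k in atTop, V k x ∈ closedBall (v z) (1 + K.toReal) := by
    have h1 := (frequently_lt_of_liminf_lt (by isBoundedDefault) hK.1).and_eventually
      (hz.eventually (ball_mem_nhds _ one_pos))
    refine h1.mono fun k hk => ?_
    have h2 : dist (V k x) (V k z) ≤ K.toReal := by
      rw [dist_comm, dist_eq_norm, ← toReal_enorm]
      exact ENNReal.toReal_mono hK.2.ne hk.1.le
    have h3 : dist (V k z) (v z) < 1 := hk.2
    rw [mem_closedBall]
    linarith [dist_triangle (V k x) (V k z) (v z)]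
  obtain ⟨L, -, ψ, hψ, hL⟩ := tendsto_subseq_of_frequently_bounded isBounded_closedBall hfreq
  refine ⟨L, fun s hs hsR => ?_⟩
  calc ∫⁻ z in ball x s, ‖v z - L‖ₑ
      = ∫⁻ z in ball x s, liminf (fun k => ‖V (ψ k) z - V (ψ k) x‖ₑ) atTop := by
        refine lintegral_congr_ae ((ae_restrict_of_ae hae).mono fun z hz => ?_)
        exact (((hz.comp hψ.tendsto_atTop).sub hL).enorm).liminf_eq.symm
    _ ≤ liminf (fun k => ∫⁻ z in ball x s, ‖V (ψ k) z - V (ψ k) x‖ₑ) atTop :=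
        lintegral_liminf_le fun k => hmeas _
    _ ≤ ENNReal.ofReal s * (4 ^ n * A) * volume (ball x s) := by
        refine liminf_le_of_le (by isBoundedDefault) fun b hb => ?_
        obtain ⟨k, hk⟩ := hb.exists
        exact hk.trans (hest _ s hs hsR)

/-- `L` is the value of `f` at `x` in the sense of Lebesgue points. -/
def HasLebesgueValue {n : ℕ} (f : EuclideanSpace ℝ (Fin n) → ℝ)
    (x : EuclideanSpace ℝ (Fin n)) (L : ℝ) : Prop :=
  Tendsto (fun r : ℝ => (volume (ball x r))⁻¹ * ∫⁻ z in ball x r, ‖f z - L‖ₑ) (𝓝[>] 0) (𝓝 0)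

namespace HasLebesgueValue

variable {n : ℕ} {f g P : EuclideanSpace ℝ (Fin n) → ℝ} {x : EuclideanSpace ℝ (Fin n)} {L M : ℝ}

theorem rep_eq (h : HasLebesgueValue f x L) (hf : LocallyIntegrable f volume) :
    rep f x = L := by
  refine Tendsto.limsup_eq ?_
  rw [tendsto_iff_edist_tendsto_0]
  refine tendsto_of_tendsto_of_tendsto_of_le_of_le' tendsto_const_nhds h
    (Eventually.of_forall fun _ => zero_le) ?_
  filter_upwards [self_mem_nhdsWithin] with r hr
  have hr' : 0 < r := hr
  have h0 : volume (ball x r) ≠ 0 := (measure_ball_pos _ _ hr').ne'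
  have hfi : IntegrableOn f (ball x r) volume :=
    (hf.integrableOn_isCompact (isCompact_closedBall x r)).mono_set ball_subset_closedBall
  have hL : ⨍ _ in ball x r, L = L := setAverage_const h0 measure_ball_lt_top.ne L
  have hsub : (⨍ z in ball x r, f z) - L = ⨍ z in ball x r, (f z - L) := by
    conv_lhs => rw [← hL]
    simp only [setAverage_eq]
    rw [integral_sub hfi (integrableOn_const measure_ball_lt_top.ne), smul_sub]
  rw [edist_eq_enorm_sub, hsub, setAverage_eq, enorm_smul]
  gcongr
  · rw [Real.enorm_of_nonneg (by positivity), Measure.real,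
      ENNReal.ofReal_inv_of_pos (ENNReal.toReal_pos h0 measure_ball_lt_top.ne),
      ENNReal.ofReal_toReal measure_ball_lt_top.ne]
  · exact enorm_integral_le_lintegral_enorm _

theorem of_le {R : ℝ} (hR : 0 < R) {B : ℝ≥0∞} (hB : B ≠ ∞)
    (h : ∀ s, 0 < s → s ≤ R →
      ∫⁻ z in ball x s, ‖f z - L‖ₑ ≤ ENNReal.ofReal s * B * volume (ball x s)) :
    HasLebesgueValue f x L := by
  have h1 : Tendsto (fun r : ℝ => ENNReal.ofReal r * B) (𝓝[>] 0) (𝓝 0) := by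
    have h2 : Tendsto (fun r : ℝ => ENNReal.ofReal r) (𝓝[>] 0) (𝓝 0) := by
      simpa using (ENNReal.continuous_ofReal.tendsto (0 : ℝ)).mono_left nhdsWithin_le_nhds
    simpa using ENNReal.Tendsto.mul_const h2 (Or.inr hB)
  refine tendsto_of_tendsto_of_tendsto_of_le_of_le' tendsto_const_nhds h1
    (Eventually.of_forall fun _ => zero_le) ?_
  filter_upwards [Ioc_mem_nhdsGT hR] with r hr
  calc (volume (ball x r))⁻¹ * ∫⁻ z in ball x r, ‖f z - L‖ₑ
      ≤ (volume (ball x r))⁻¹ * (ENNReal.ofReal r * B * volume (ball x r)) := by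
        gcongr
        exact h r hr.1 hr.2
    _ = ENNReal.ofReal r * B := by
        rw [mul_comm, mul_assoc, ENNReal.mul_inv_cancel (measure_ball_pos _ _ hr.1).ne'
          measure_ball_lt_top.ne, mul_one]

theorem zero : HasLebesgueValue (fun _ => 0) x 0 := by
  simp [HasLebesgueValue]

theorem add (hf : HasLebesgueValue f x L) (hg : HasLebesgueValue g x M)
    (hfm : LocallyIntegrable f volume) :
    HasLebesgueValue (fun z => f z + g z) x (L + M) := by
  have h := Tendsto.add hf hg
  rw [add_zero] at h
  refine tendsto_of_tendsto_of_tendsto_of_le_of_le tendsto_const_nhds h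
    (fun _ => zero_le) fun r => ?_
  have hm : AEMeasurable (fun z => ‖f z - L‖ₑ) (volume.restrict (ball x r)) :=
    (hfm.aestronglyMeasurable.sub aestronglyMeasurable_const).enorm.restrict
  dsimp only
  rw [← mul_add, ← lintegral_add_left' hm]
  gcongr with z
  rw [add_sub_add_comm]
  exact enorm_add_le _ _

theorem sum {ι : Type*} {S : Finset ι} {f : ι → EuclideanSpace ℝ (Fin n) → ℝ} {L : ι → ℝ}
    (h : ∀ a ∈ S, HasLebesgueValue (f a) x (L a))
    (hf : ∀ a ∈ S, LocallyIntegrable (f a) volume) :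
    HasLebesgueValue (fun z => ∑ a ∈ S, f a z) x (∑ a ∈ S, L a) := by
  classical
  induction S using Finset.induction_on with
  | empty => simpa using zero
  | insert a S ha ih =>
    simp only [Finset.sum_insert ha]
    exact (h a (Finset.mem_insert_self a S)).add
      (ih (fun b hb => h b (Finset.mem_insert_of_mem hb))
        fun b hb => hf b (Finset.mem_insert_of_mem hb)) (hf a (Finset.mem_insert_self a S))

theorem mul_continuous (hf : HasLebesgueValue f x L) (hP : Continuous P) :
    HasLebesgueValue (fun z => f z * P z) x (L * P x) := by
  refine ENNReal.tendsto_nhds_zero.2 fun ε hε => ?_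
  have hlim : Tendsto (fun r : ℝ => (‖P x‖ₑ + 1) *
      ((volume (ball x r))⁻¹ * ∫⁻ z in ball x r, ‖f z - L‖ₑ)) (𝓝[>] 0) (𝓝 0) := by
    simpa using ENNReal.Tendsto.const_mul (a := ‖P x‖ₑ + 1) hf (Or.inr (by finiteness))
  have hK : ∀ᶠ z in 𝓝 x, ‖P z‖ₑ < ‖P x‖ₑ + 1 :=
    hP.enorm.continuousAt.eventually_lt continuousAt_const (ENNReal.lt_add_right (by finiteness) one_ne_zero)
  have hPx : ∀ᶠ z in 𝓝 x, ‖L * (P z - P x)‖ₑ < ε / 2 := by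
    have hc : Continuous fun z => ‖L * (P z - P x)‖ₑ := by fun_prop
    exact hc.continuousAt.eventually_lt continuousAt_const
      (by simpa using ENNReal.half_pos hε.ne')
  obtain ⟨δ, hδ, hδx⟩ := Metric.eventually_nhds_iff_ball.1 (hK.and hPx)
  filter_upwards [(ENNReal.tendsto_nhds_zero.1 hlim) (ε / 2) (ENNReal.half_pos hε.ne'),
    Ioc_mem_nhdsGT hδ] with r hr1 hr2
  have h0 : volume (ball x r) ≠ 0 := (measure_ball_pos _ _ hr2.1).ne'
  calc (volume (ball x r))⁻¹ * ∫⁻ z in ball x r, ‖f z * P z - L * P x‖ₑ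
      ≤ (volume (ball x r))⁻¹ *
        ∫⁻ z in ball x r, ((‖P x‖ₑ + 1) * ‖f z - L‖ₑ + ε / 2) := by
        gcongr (volume (ball x r))⁻¹ * ?_
        refine setLIntegral_mono' (measurableSet_ball (x := x) (ε := r)) fun z hz => ?_
        have hz' := hδx z (ball_subset_ball hr2.2 hz)
        have : f z * P z - L * P x = P z * (f z - L) + L * (P z - P x) := by ring
        rw [this]
        refine (enorm_add_le _ _).trans (add_le_add ?_ hz'.2.le)
        rw [enorm_mul]
        gcongr
        exact hz'.1.le
    _ = (‖P x‖ₑ + 1) * ((volume (ball x r))⁻¹ * ∫⁻ z in ball x r, ‖f z - L‖ₑ) + ε / 2 := by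
        rw [lintegral_add_right _ measurable_const, lintegral_const_mul' _ _ (by finiteness),
          setLIntegral_const, mul_add, mul_left_comm, mul_left_comm _ (ε / 2),
          ENNReal.inv_mul_cancel h0 measure_ball_lt_top.ne, mul_one]
    _ ≤ ε := (add_le_add hr1 le_rfl).trans_eq (ENNReal.add_halves ε)

end HasLebesgueValue

/-- The averages of `|f|` over balls centred at `x` of bounded radius are bounded. -/
def BoundedAverages {n : ℕ} (f : EuclideanSpace ℝ (Fin n) → ℝ)
    (x : EuclideanSpace ℝ (Fin n)) : Prop :=
  ∀ R : ℝ, 0 < R → ∃ A : ℝ≥0∞, A ≠ ∞ ∧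
    ∀ s, 0 < s → s ≤ R → ∫⁻ z in ball x s, ‖f z‖ₑ ≤ A * volume (ball x s)

theorem boundedAverages_of_gradient {n : ℕ} {v : EuclideanSpace ℝ (Fin n) → ℝ}
    {G : Fin n → EuclideanSpace ℝ (Fin n) → ℝ} (hv : LocallyIntegrable v volume)
    (hG : ∀ i, LocallyIntegrable (G i) volume) (hvG : ∀ i, HasWeakPartialDeriv v (G i) i)
    {x : EuclideanSpace ℝ (Fin n)} (h : ∀ i, BoundedAverages (G i) x) :
    (∃ L, HasLebesgueValue v x L) ∧ BoundedAverages v x := by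
  have key : ∀ R : ℝ, 0 < R → ∃ L : ℝ, ∃ B : ℝ≥0∞, B ≠ ∞ ∧ ∀ s, 0 < s → s ≤ R →
      ∫⁻ z in ball x s, ‖v z - L‖ₑ ≤ ENNReal.ofReal s * B * volume (ball x s) := by
    intro R hR
    choose A hAtop hA using fun i => h i (2 * R) (by positivity)
    obtain ⟨L, hL⟩ := exists_setLIntegral_enorm_sub_le hv hG hvG (x := x) (R := 2 * R)
      (by positivity) (A := ∑ i, A i) (by simpa using hAtop) (fun s hs hsR => by
        rw [lintegral_finsetSum' _ fun i _ => (hG i).aestronglyMeasurable.enorm.restrict,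
          Finset.sum_mul]
        exact Finset.sum_le_sum fun i _ => hA i s hs hsR)
    exact ⟨L, 4 ^ n * ∑ i, A i, ENNReal.mul_ne_top (by simp) (by simpa using hAtop),
      fun s hs hsR => hL s hs (by linarith)⟩
  refine ⟨?_, fun R hR => ?_⟩
  · obtain ⟨L, B, hB, h1⟩ := key 1 one_pos
    exact ⟨L, HasLebesgueValue.of_le one_pos hB h1⟩
  · obtain ⟨L, B, hB, h1⟩ := key R hR
    refine ⟨ENNReal.ofReal R * B + ‖L‖ₑ, by finiteness, fun s hs hsR => ?_⟩
    calc ∫⁻ z in ball x s, ‖v z‖ₑ ≤ ∫⁻ z in ball x s, (‖v z - L‖ₑ + ‖L‖ₑ) := by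
          gcongr with z
          simpa using enorm_add_le (v z - L) L
      _ = (∫⁻ z in ball x s, ‖v z - L‖ₑ) + ‖L‖ₑ * volume (ball x s) := by
          rw [lintegral_add_right _ measurable_const, setLIntegral_const]
      _ ≤ ENNReal.ofReal R * B * volume (ball x s) + ‖L‖ₑ * volume (ball x s) := by
          gcongr
          refine (h1 s hs hsR).trans ?_
          gcongr
      _ = _ := by rw [add_mul]

theorem sum_add_single {n : ℕ} (α : Fin n → ℕ) (i : Fin n) :
    ∑ j, (α + Pi.single i 1 : Fin n → ℕ) j = (∑ j, α j) + 1 := by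
  simp [Finset.sum_add_distrib]

theorem WeakDerivFamily.boundedAverages {n m : ℕ} {u : EuclideanSpace ℝ (Fin n) → ℝ}
    {D : (Fin n → ℕ) → EuclideanSpace ℝ (Fin n) → ℝ} (hD : WeakDerivFamily m u D)
    (hint : ∀ α : Fin n → ℕ, (∑ j, α j) ≤ m → LocallyIntegrable (D α) volume)
    {x : EuclideanSpace ℝ (Fin n)}
    (hm : ∀ α : Fin n → ℕ, (∑ j, α j) = m → BoundedAverages (D α) x)
    (α : Fin n → ℕ) (hα : (∑ j, α j) ≤ m) : BoundedAverages (D α) x := by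
  obtain ⟨k, hk⟩ := Nat.exists_eq_add_of_le hα
  induction k generalizing α with
  | zero => exact hm α (by omega)
  | succ k ih =>
    exact (boundedAverages_of_gradient (hint α hα)
      (fun i => hint _ (by rw [sum_add_single]; omega)) (fun i => hD.2 α i (by omega))
      fun i => ih _ (by rw [sum_add_single]; omega) (by rw [sum_add_single]; omega)).2

theorem WeakDerivFamily.hasLebesgueValue {n m : ℕ} {u : EuclideanSpace ℝ (Fin n) → ℝ}
    {D : (Fin n → ℕ) → EuclideanSpace ℝ (Fin n) → ℝ} (hD : WeakDerivFamily m u D)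
    (hint : ∀ α : Fin n → ℕ, (∑ j, α j) ≤ m → LocallyIntegrable (D α) volume)
    {x : EuclideanSpace ℝ (Fin n)}
    (hm : ∀ α : Fin n → ℕ, (∑ j, α j) = m → BoundedAverages (D α) x)
    (α : Fin n → ℕ) (hα : (∑ j, α j) < m) : HasLebesgueValue (D α) x (rep (D α) x) := by
  obtain ⟨L, hL⟩ := (boundedAverages_of_gradient (hint α hα.le)
      (fun i => hint _ (by rw [sum_add_single]; omega)) (fun i => hD.2 α i hα)
      fun i => hD.boundedAverages hint hm (α + Pi.single i 1) (by rw [sum_add_single]; omega)).1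
  rwa [hL.rep_eq (hint α hα.le)]

namespace HasWeakPartialDeriv

variable {n : ℕ} {i : Fin n}

/-- Leibniz rule for a weak derivative times a smooth function. -/
theorem mul_contDiff {f g P : EuclideanSpace ℝ (Fin n) → ℝ} (h : HasWeakPartialDeriv f g i)
    (hf : LocallyIntegrable f volume) (hg : LocallyIntegrable g volume)
    (hP : ContDiff ℝ (⊤ : ℕ∞) P) :
    HasWeakPartialDeriv (fun z => f z * P z)
      (fun z => g z * P z + f z * fderiv ℝ P z (EuclideanSpace.single i 1)) i := by
  intro φ hφ hφc
  have hdP : Continuous fun z => fderiv ℝ P z (EuclideanSpace.single i 1) :=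
    (hP.continuous_fderiv (by simp)).clm_apply continuous_const
  have hdφ : Continuous fun z => fderiv ℝ φ z (EuclideanSpace.single i 1) :=
    (hφ.continuous_fderiv (by simp)).clm_apply continuous_const
  have key := h (fun z => P z * φ z) (hP.mul hφ) hφc.mul_left
  have hd : ∀ z, fderiv ℝ (fun z => P z * φ z) z (EuclideanSpace.single i 1)
      = P z * fderiv ℝ φ z (EuclideanSpace.single i 1)
        + φ z * fderiv ℝ P z (EuclideanSpace.single i 1) := by
    intro z
    rw [fderiv_fun_mul (hP.differentiable (by simp) z) (hφ.differentiable (by simp) z)]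
    simp
  simp only [hd] at key
  have hcd : HasCompactSupport fun z => fderiv ℝ φ z (EuclideanSpace.single i 1) :=
    (hφc.fderiv ℝ).comp_left (g := fun T : EuclideanSpace ℝ (Fin n) →L[ℝ] ℝ =>
      T (EuclideanSpace.single i 1)) rfl
  have i1 : Integrable (fun z => f z * (P z * fderiv ℝ φ z (EuclideanSpace.single i 1))) :=
    hf.integrable_smul_right_of_hasCompactSupport (hP.continuous.mul hdφ) hcd.mul_left
  have i2 : Integrable (fun z => f z * (φ z * fderiv ℝ P z (EuclideanSpace.single i 1))) :=
    hf.integrable_smul_right_of_hasCompactSupport (hφ.continuous.mul hdP) hφc.mul_right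
  have i3 : Integrable (fun z => g z * (P z * φ z)) :=
    hg.integrable_smul_right_of_hasCompactSupport (hP.continuous.mul hφ.continuous) hφc.mul_left
  simp only [mul_add] at key
  rw [integral_add i1 i2] at key
  calc ∫ z, f z * P z * fderiv ℝ φ z (EuclideanSpace.single i 1)
      = ∫ z, f z * (P z * fderiv ℝ φ z (EuclideanSpace.single i 1)) := by simp only [mul_assoc]
    _ = -((∫ z, g z * (P z * φ z)) +
          ∫ z, f z * (φ z * fderiv ℝ P z (EuclideanSpace.single i 1))) := by linarith
    _ = -∫ z, (g z * P z + f z * fderiv ℝ P z (EuclideanSpace.single i 1)) * φ z := by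
        rw [← integral_add i3 i2]
        congr 2
        ext z
        ring

theorem sum {ι : Type*} {S : Finset ι} {f g : ι → EuclideanSpace ℝ (Fin n) → ℝ}
    (h : ∀ a ∈ S, HasWeakPartialDeriv (f a) (g a) i)
    (hf : ∀ a ∈ S, LocallyIntegrable (f a) volume)
    (hg : ∀ a ∈ S, LocallyIntegrable (g a) volume) :
    HasWeakPartialDeriv (fun z => ∑ a ∈ S, f a z) (fun z => ∑ a ∈ S, g a z) i := by
  intro φ hφ hφc
  have hdφ : Continuous fun z => fderiv ℝ φ z (EuclideanSpace.single i 1) :=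
    (hφ.continuous_fderiv (by simp)).clm_apply continuous_const
  have hcd : HasCompactSupport fun z => fderiv ℝ φ z (EuclideanSpace.single i 1) :=
    (hφc.fderiv ℝ).comp_left (g := fun T : EuclideanSpace ℝ (Fin n) →L[ℝ] ℝ =>
      T (EuclideanSpace.single i 1)) rfl
  simp only [Finset.sum_mul]
  have i1 : ∀ a ∈ S, Integrable fun z =>
      f a z * fderiv ℝ φ z (EuclideanSpace.single i 1) := fun a ha =>
    (hf a ha).integrable_smul_right_of_hasCompactSupport hdφ hcd
  have i2 : ∀ a ∈ S, Integrable fun z => g a z * φ z := fun a ha =>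
    (hg a ha).integrable_smul_right_of_hasCompactSupport hφ.continuous hφc
  rw [integral_finsetSum _ i1, integral_finsetSum _ i2, ← Finset.sum_neg_distrib]
  exact Finset.sum_congr rfl fun a ha => h a ha φ hφ hφc

end HasWeakPartialDeriv

/-- The Taylor monomial `(y - z)^α / α!`. -/
noncomputable def taylorMonomial {n : ℕ} (y : EuclideanSpace ℝ (Fin n)) (α : Fin n → ℕ)
    (z : EuclideanSpace ℝ (Fin n)) : ℝ :=
  (∏ j, (y j - z j) ^ α j) / ∏ j, (Nat.factorial (α j) : ℝ)

section taylorMonomial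

variable {n : ℕ} (y z : EuclideanSpace ℝ (Fin n)) (α : Fin n → ℕ) (i : Fin n)

theorem contDiff_taylorMonomial : ContDiff ℝ (⊤ : ℕ∞) (taylorMonomial y α) := by
  unfold taylorMonomial
  refine ContDiff.div_const (contDiff_prod fun j _ => ?_) _
  fun_prop

theorem taylorMonomial_eq_prod :
    taylorMonomial y α z = ∏ j, ((y j - z j) ^ α j / (Nat.factorial (α j) : ℝ)) := by
  simp [taylorMonomial, Finset.prod_div_distrib]

theorem taylorMonomial_zero : taylorMonomial y 0 z = 1 := by
  simp [taylorMonomial]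

theorem taylorMonomial_self (hα : α ≠ 0) : taylorMonomial y α y = 0 := by
  obtain ⟨j, hj⟩ := Function.ne_iff.1 hα
  rw [taylorMonomial_eq_prod]
  refine Finset.prod_eq_zero (Finset.mem_univ j) ?_
  simp [zero_pow hj]

theorem abs_taylorMonomial_le : |taylorMonomial y α z| ≤ ‖y - z‖ ^ ∑ j, α j := by
  rw [taylorMonomial_eq_prod, Finset.abs_prod, ← Finset.prod_pow_eq_pow_sum]
  refine Finset.prod_le_prod (fun _ _ => abs_nonneg _) fun j _ => ?_
  rw [abs_div, abs_pow, Nat.abs_cast]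
  refine (div_le_self (by positivity) (by exact_mod_cast Nat.factorial_pos _)).trans ?_
  gcongr
  exact PiLp.norm_apply_le (y - z) j

theorem fderiv_taylorMonomial_single :
    fderiv ℝ (taylorMonomial y α) z (EuclideanSpace.single i 1)
      = (∏ j ∈ Finset.univ.erase i, ((y j - z j) ^ α j / (Nat.factorial (α j) : ℝ))) *
        (-(α i * (y i - z i) ^ (α i - 1)) / (Nat.factorial (α i) : ℝ)) := by
  rw [← ((contDiff_taylorMonomial y α).differentiable (by simp) z).lineDeriv_eq_fderiv]
  refine HasLineDerivAt.lineDeriv ?_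
  have h1 : (fun t : ℝ => taylorMonomial y α (z + t • EuclideanSpace.single i 1))
      = fun t => (∏ j ∈ Finset.univ.erase i, ((y j - z j) ^ α j / (Nat.factorial (α j) : ℝ))) *
        ((y i - (z i + t)) ^ α i / (Nat.factorial (α i) : ℝ)) := by
    ext t
    rw [taylorMonomial_eq_prod, ← Finset.prod_erase_mul _ _ (Finset.mem_univ i)]
    congr 1
    · refine Finset.prod_congr rfl fun j hj => ?_
      simp [(Finset.ne_of_mem_erase hj)]
    · simp
  rw [HasLineDerivAt, h1]
  have h2 : HasDerivAt (fun t : ℝ => y i - (z i + t)) (-1) 0 :=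
    ((hasDerivAt_id (0 : ℝ)).const_add (z i)).const_sub (y i)
  have h3 := ((h2.pow (α i)).div_const (Nat.factorial (α i) : ℝ)).const_mul
    (∏ j ∈ Finset.univ.erase i, ((y j - z j) ^ α j / (Nat.factorial (α j) : ℝ)))
  exact h3.congr_deriv (by simp)

theorem fderiv_taylorMonomial_of_eq_zero (h : α i = 0) :
    fderiv ℝ (taylorMonomial y α) z (EuclideanSpace.single i 1) = 0 := by
  simp [fderiv_taylorMonomial_single, h]

theorem fderiv_taylorMonomial_add_single :
    fderiv ℝ (taylorMonomial y (α + Pi.single i 1)) z (EuclideanSpace.single i 1)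
      = - taylorMonomial y α z := by
  rw [fderiv_taylorMonomial_single, taylorMonomial_eq_prod,
    ← Finset.prod_erase_mul Finset.univ
      (fun j => (y j - z j) ^ α j / (Nat.factorial (α j) : ℝ)) (Finset.mem_univ i),
    ← mul_neg (∏ j ∈ Finset.univ.erase i, ((y j - z j) ^ α j / (Nat.factorial (α j) : ℝ)))]
  congr 1
  · refine Finset.prod_congr rfl fun j hj => ?_
    simp [(Finset.ne_of_mem_erase hj)]
  · simp only [Pi.add_apply, Pi.single_eq_same, add_tsub_cancel_right, Nat.factorial_succ]
    push_cast
    have : (Nat.factorial (α i) : ℝ) ≠ 0 := by positivity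
    field_simp

end taylorMonomial

/-- Shifting all multi-indices of degree `k` in direction `i` captures every term of degree
`k + 1` that is not killed by `∂ᵢ`. -/
theorem sum_piAntidiag_succ_of_eq_zero {n : ℕ} (i : Fin n) (k : ℕ) (F : (Fin n → ℕ) → ℝ)
    (hF : ∀ α, α i = 0 → F α = 0) :
    ∑ α ∈ Finset.piAntidiag Finset.univ (k + 1), F α
      = ∑ β ∈ Finset.piAntidiag Finset.univ k, F (β + Pi.single i 1) := by
  classical
  have hinj : Set.InjOn (fun β : Fin n → ℕ => β + Pi.single i 1)
      (Finset.piAntidiag Finset.univ k : Finset (Fin n → ℕ)) :=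
    fun a _ b _ h => add_right_cancel h
  rw [← Finset.sum_image (f := F) hinj]
  symm
  refine Finset.sum_subset (fun α hα => ?_) fun α hα hα' => hF α ?_
  · obtain ⟨β, hβ, rfl⟩ := Finset.mem_image.1 hα
    have h1 : ∑ j, β j = k := by simpa using hβ
    rw [Finset.mem_piAntidiag]
    exact ⟨by rw [sum_add_single, h1], fun _ _ => Finset.mem_univ _⟩
  · by_contra h0
    have hle : Pi.single i 1 ≤ α := by
      intro j
      by_cases hj : j = i
      · subst hj; simpa using Nat.one_le_iff_ne_zero.2 h0
      · simp [hj]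
    apply hα'
    refine Finset.mem_image.2 ⟨α - Pi.single i 1, ?_, tsub_add_cancel_of_le hle⟩
    have h1 : ∑ j, α j = k + 1 := by simpa using hα
    rw [← tsub_add_cancel_of_le hle, sum_add_single] at h1
    rw [Finset.mem_piAntidiag]
    have h2 : ∑ j, (α - Pi.single i 1 : Fin n → ℕ) j = k := by omega
    exact ⟨h2, fun _ _ => Finset.mem_univ _⟩

/-- `z ↦ T_z^{k-1} u (y)`, the Taylor polynomial evaluated at `y`, as a function of the base
point. -/
noncomputable def taylorAt {n : ℕ} (D : (Fin n → ℕ) → EuclideanSpace ℝ (Fin n) → ℝ)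
    (y : EuclideanSpace ℝ (Fin n)) (k : ℕ) (z : EuclideanSpace ℝ (Fin n)) : ℝ :=
  ∑ j ∈ Finset.range k, ∑ α ∈ Finset.piAntidiag Finset.univ j, D α z * taylorMonomial y α z

/-- The `i`-th weak derivative of `taylorAt D y (k + 1)`. -/
noncomputable def taylorAtDeriv {n : ℕ} (D : (Fin n → ℕ) → EuclideanSpace ℝ (Fin n) → ℝ)
    (y : EuclideanSpace ℝ (Fin n)) (k : ℕ) (i : Fin n) (z : EuclideanSpace ℝ (Fin n)) : ℝ :=
  ∑ α ∈ Finset.piAntidiag Finset.univ k, D (α + Pi.single i 1) z * taylorMonomial y α z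

theorem sum_sum_eq_taylorAtDeriv {n : ℕ} (D : (Fin n → ℕ) → EuclideanSpace ℝ (Fin n) → ℝ)
    (y : EuclideanSpace ℝ (Fin n)) (k : ℕ) (i : Fin n) (z : EuclideanSpace ℝ (Fin n)) :
    ∑ j ∈ Finset.range (k + 1), ∑ α ∈ Finset.piAntidiag Finset.univ j,
        (D (α + Pi.single i 1) z * taylorMonomial y α z
          + D α z * fderiv ℝ (taylorMonomial y α) z (EuclideanSpace.single i 1))
      = taylorAtDeriv D y k i z := by
  induction k with
  | zero => simp [taylorAtDeriv, fderiv_taylorMonomial_of_eq_zero]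
  | succ k ih =>
    rw [Finset.sum_range_succ, ih, Finset.sum_add_distrib,
      sum_piAntidiag_succ_of_eq_zero i k
        (fun α => D α z * fderiv ℝ (taylorMonomial y α) z (EuclideanSpace.single i 1))
        fun α hα => by simp [fderiv_taylorMonomial_of_eq_zero y z α i hα]]
    simp [fderiv_taylorMonomial_add_single, taylorAtDeriv]

section taylorAt

variable {n k : ℕ} {u : EuclideanSpace ℝ (Fin n) → ℝ}
  {D : (Fin n → ℕ) → EuclideanSpace ℝ (Fin n) → ℝ}

theorem locallyIntegrable_taylorAt
    (hint : ∀ α : Fin n → ℕ, (∑ j, α j) ≤ k → LocallyIntegrable (D α) volume)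
    (y : EuclideanSpace ℝ (Fin n)) : LocallyIntegrable (taylorAt D y k) volume := by
  refine locallyIntegrable_finsetSum _ fun j hj => locallyIntegrable_finsetSum _ fun α hα => ?_
  have h1 : ∑ j, α j = j := by simpa using hα
  have h2 := Finset.mem_range.1 hj
  exact LocallyIntegrable.mul_continuous (contDiff_taylorMonomial y α).continuous
    (hint α (by omega))

theorem locallyIntegrable_taylorAtDeriv
    (hint : ∀ α : Fin n → ℕ, (∑ j, α j) ≤ k + 1 → LocallyIntegrable (D α) volume)
    (y : EuclideanSpace ℝ (Fin n)) (i : Fin n) :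
    LocallyIntegrable (taylorAtDeriv D y k i) volume := by
  refine locallyIntegrable_finsetSum _ fun α hα => ?_
  have h1 : ∑ j, α j = k := by simpa using hα
  exact LocallyIntegrable.mul_continuous (contDiff_taylorMonomial y α).continuous
    (hint _ (by rw [sum_add_single]; omega))

theorem WeakDerivFamily.hasWeakPartialDeriv_taylorAt (hD : WeakDerivFamily (k + 1) u D)
    (hint : ∀ α : Fin n → ℕ, (∑ j, α j) ≤ k + 1 → LocallyIntegrable (D α) volume)
    (y : EuclideanSpace ℝ (Fin n)) (i : Fin n) :
    HasWeakPartialDeriv (taylorAt D y (k + 1)) (taylorAtDeriv D y k i) i := by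
  have hcd : ∀ α, Continuous fun z =>
      fderiv ℝ (taylorMonomial y α) z (EuclideanSpace.single i 1) := fun α =>
    ((contDiff_taylorMonomial y α).continuous_fderiv (by simp)).clm_apply continuous_const
  have hf : ∀ α : Fin n → ℕ, ∑ j, α j ≤ k →
      LocallyIntegrable (fun z => D α z * taylorMonomial y α z) volume := fun α hα =>
    LocallyIntegrable.mul_continuous (contDiff_taylorMonomial y α).continuous
      (hint α (by omega))
  have hg : ∀ α : Fin n → ℕ, ∑ j, α j ≤ k →
      LocallyIntegrable (fun z => D (α + Pi.single i 1) z * taylorMonomial y α z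
        + D α z * fderiv ℝ (taylorMonomial y α) z (EuclideanSpace.single i 1)) volume :=
    fun α hα => (LocallyIntegrable.mul_continuous (contDiff_taylorMonomial y α).continuous
      (hint _ (by rw [sum_add_single]; omega))).add
      (LocallyIntegrable.mul_continuous (hcd α) (hint α (by omega)))
  have hdeg : ∀ j ∈ Finset.range (k + 1), ∀ α ∈ Finset.piAntidiag (Finset.univ : Finset (Fin n)) j,
      ∑ l, α l ≤ k := fun j hj α hα => by
    have h1 : ∑ l, α l = j := by simpa using hα
    have h2 := Finset.mem_range.1 hj
    omega
  have h := HasWeakPartialDeriv.sum (S := Finset.range (k + 1)) (i := i)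
    (f := fun j z => ∑ α ∈ Finset.piAntidiag Finset.univ j, D α z * taylorMonomial y α z)
    (g := fun j z => ∑ α ∈ Finset.piAntidiag Finset.univ j,
      (D (α + Pi.single i 1) z * taylorMonomial y α z
        + D α z * fderiv ℝ (taylorMonomial y α) z (EuclideanSpace.single i 1)))
    (fun j hj => HasWeakPartialDeriv.sum
      (fun α hα => (hD.2 α i (by have := hdeg j hj α hα; omega)).mul_contDiff
        (hint α (by have := hdeg j hj α hα; omega))
        (hint _ (by have := hdeg j hj α hα; rw [sum_add_single]; omega))
        (contDiff_taylorMonomial y α))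
      (fun α hα => hf α (hdeg j hj α hα)) (fun α hα => hg α (hdeg j hj α hα)))
    (fun j hj => locallyIntegrable_finsetSum _ fun α hα => hf α (hdeg j hj α hα))
    (fun j hj => locallyIntegrable_finsetSum _ fun α hα => hg α (hdeg j hj α hα))
  simp only [sum_sum_eq_taylorAtDeriv] at h
  exact h

/-- The function `taylorAt D y k` has the Lebesgue value at `p` given by the precise
representatives of the derivatives. -/
theorem WeakDerivFamily.hasLebesgueValue_taylorAt (hD : WeakDerivFamily k u D)
    (hint : ∀ α : Fin n → ℕ, (∑ j, α j) ≤ k → LocallyIntegrable (D α) volume)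
    {p : EuclideanSpace ℝ (Fin n)}
    (hp : ∀ α : Fin n → ℕ, (∑ j, α j) = k → BoundedAverages (D α) p)
    (y : EuclideanSpace ℝ (Fin n)) :
    HasLebesgueValue (taylorAt D y k) p (taylorAt (fun α => rep (D α)) y k p) := by
  have hdeg : ∀ j ∈ Finset.range k, ∀ α ∈ Finset.piAntidiag (Finset.univ : Finset (Fin n)) j,
      ∑ l, α l < k := fun j hj α hα => by
    have h1 : ∑ l, α l = j := by simpa using hα
    have h2 := Finset.mem_range.1 hj
    omega
  have hf : ∀ α : Fin n → ℕ, ∑ j, α j < k →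
      LocallyIntegrable (fun z => D α z * taylorMonomial y α z) volume := fun α hα =>
    LocallyIntegrable.mul_continuous (contDiff_taylorMonomial y α).continuous (hint α hα.le)
  exact HasLebesgueValue.sum (fun j hj => HasLebesgueValue.sum
      (fun α hα => (hD.hasLebesgueValue hint hp α (hdeg j hj α hα)).mul_continuous
        (contDiff_taylorMonomial y α).continuous)
      (fun α hα => hf α (hdeg j hj α hα)))
    (fun j hj => locallyIntegrable_finsetSum _ fun α hα => hf α (hdeg j hj α hα))

theorem taylorAt_self (D : (Fin n → ℕ) → EuclideanSpace ℝ (Fin n) → ℝ)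
    (y : EuclideanSpace ℝ (Fin n)) (k : ℕ) : taylorAt D y (k + 1) y = D 0 y := by
  rw [taylorAt, Finset.sum_range_succ', Finset.sum_eq_zero, zero_add]
  · simp [taylorMonomial_zero]
  · refine fun j _ => Finset.sum_eq_zero fun α hα => ?_
    have h1 : ∑ l, α l = j + 1 := by simpa using hα
    rw [taylorMonomial_self, mul_zero]
    rintro rfl
    simp at h1

theorem tsum_eq_taylorAt (D : (Fin n → ℕ) → EuclideanSpace ℝ (Fin n) → ℝ)
    (x y : EuclideanSpace ℝ (Fin n)) (k : ℕ) :
    ∑' α : {α : Fin n → ℕ // (∑ j, α j) ≤ k},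
        D α.1 x * (∏ i, (y i - x i) ^ (α.1 i)) / ∏ i, (Nat.factorial (α.1 i) : ℝ)
      = taylorAt D y (k + 1) x := by
  have hdisj : (Finset.range (k + 1) : Set ℕ).PairwiseDisjoint
      fun j => Finset.piAntidiag (Finset.univ : Finset (Fin n)) j := fun a _ b _ hab =>
    Finset.disjoint_left.2 fun α ha hb => hab <| by
      have h1 : ∑ l, α l = a := by simpa using ha
      have h2 : ∑ l, α l = b := by simpa using hb
      exact h1.symm.trans h2
  have hset : {α : Fin n → ℕ | (∑ j, α j) ≤ k} = ((Finset.range (k + 1)).biUnion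
      fun j => Finset.piAntidiag (Finset.univ : Finset (Fin n)) j : Finset (Fin n → ℕ)) := by
    ext α
    simp
  rw [taylorAt, ← Finset.sum_biUnion hdisj,
    ← Finset.tsum_subtype' _ fun α => D α x * taylorMonomial y α x, ← hset]
  exact tsum_congr fun α => mul_div_assoc _ _ _

end taylorAt

section gradmNorm

variable {n : ℕ}

theorem abs_le_gradmNorm {m : ℕ} (D : (Fin n → ℕ) → EuclideanSpace ℝ (Fin n) → ℝ)
    (p : EuclideanSpace ℝ (Fin n)) {α : Fin n → ℕ} (hα : (∑ j, α j) = m) :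
    |D α p| ≤ gradmNorm m D p := by
  have hfin : Finite {α : Fin n → ℕ // (∑ j, α j) = m} :=
    Finite.of_injective (β := Finset.piAntidiag (Finset.univ : Finset (Fin n)) m)
      (fun α => ⟨α.1, by simpa using α.2⟩) fun a b h => by
        simpa [Subtype.ext_iff] using h
  refine Real.abs_le_sqrt ?_
  exact (Summable.of_finite (f := fun α : {α : Fin n → ℕ // (∑ j, α j) = m} =>
    (D α.1 p) ^ 2)).le_tsum ⟨α, hα⟩ fun _ _ => sq_nonneg _

theorem setLIntegral_ball_le_maxFn (g : EuclideanSpace ℝ (Fin n) → ℝ)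
    (x : EuclideanSpace ℝ (Fin n)) {s : ℝ} (hs : 0 < s) :
    ∫⁻ z in ball x s, ‖g z‖ₑ ≤ maxFn g x * volume (ball x s) := by
  have h : (volume (ball x s))⁻¹ * ∫⁻ z in ball x s, ‖g z‖ₑ ≤ maxFn g x :=
    le_iSup₂ (f := fun (r : ℝ) (_ : 0 < r) =>
      (volume (ball x r))⁻¹ * ∫⁻ y in ball x r, (‖g y‖₊ : ℝ≥0∞)) s hs
  rwa [← ENNReal.div_eq_inv_mul, ENNReal.div_le_iff (measure_ball_pos _ _ hs).ne'
    measure_ball_lt_top.ne] at h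

theorem boundedAverages_of_maxFn_ne_top {m : ℕ}
    {D : (Fin n → ℕ) → EuclideanSpace ℝ (Fin n) → ℝ} {x : EuclideanSpace ℝ (Fin n)}
    (h : maxFn (gradmNorm m D) x ≠ ∞) {α : Fin n → ℕ} (hα : (∑ j, α j) = m) :
    BoundedAverages (D α) x := fun R _ => by
  refine ⟨_, h, fun s hs _ => le_trans (lintegral_mono fun z => ?_)
    (setLIntegral_ball_le_maxFn _ x hs)⟩
  exact enorm_le_iff_norm_le.2 ((abs_le_gradmNorm D z hα).trans (le_abs_self _))

/-- The gradient of `taylorAt D y (k + 1)` only involves derivatives of order `k + 1`. -/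
theorem sum_enorm_taylorAtDeriv_le (D : (Fin n → ℕ) → EuclideanSpace ℝ (Fin n) → ℝ)
    (y z : EuclideanSpace ℝ (Fin n)) (k : ℕ) {ρ : ℝ} (hρ : ‖y - z‖ ≤ ρ) :
    ∑ i, ‖taylorAtDeriv D y k i z‖ₑ
      ≤ ENNReal.ofReal (n * (Finset.piAntidiag (Finset.univ : Finset (Fin n)) k).card * ρ ^ k)
        * ‖gradmNorm (k + 1) D z‖ₑ := by
  have hρ0 : 0 ≤ ρ := (norm_nonneg _).trans hρ
  have h0 : 0 ≤ gradmNorm (k + 1) D z := Real.sqrt_nonneg _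
  have h1 : ∀ i, ‖taylorAtDeriv D y k i z‖
      ≤ (Finset.piAntidiag (Finset.univ : Finset (Fin n)) k).card *
        (gradmNorm (k + 1) D z * ρ ^ k) := by
    intro i
    refine (norm_sum_le_of_le (f := fun α => D (α + Pi.single i 1) z * taylorMonomial y α z)
      (n := fun _ => gradmNorm (k + 1) D z * ρ ^ k) _ fun α hα => ?_).trans_eq (by simp)
    have hk : ∑ j, α j = k := by simpa using hα
    rw [norm_mul]
    refine mul_le_mul (abs_le_gradmNorm D z (by rw [sum_add_single, hk])) ?_ (norm_nonneg _) h0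
    refine (abs_taylorMonomial_le y z α).trans ?_
    rw [hk]
    gcongr
  calc ∑ i, ‖taylorAtDeriv D y k i z‖ₑ
      ≤ ∑ _i : Fin n, ENNReal.ofReal ((Finset.piAntidiag (Finset.univ : Finset (Fin n)) k).card *
        (gradmNorm (k + 1) D z * ρ ^ k)) := by
        gcongr with i
        rw [← ofReal_norm]
        exact ENNReal.ofReal_le_ofReal (h1 i)
    _ = _ := by
        rw [Real.enorm_of_nonneg h0, ← ENNReal.ofReal_mul (by positivity), Finset.sum_const,
          Finset.card_univ, Fintype.card_fin, ← ENNReal.ofReal_nsmul, nsmul_eq_mul]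
        congr 1
        ring

end gradmNorm

/-- Two constants approximating the same function in mean over two balls of radius `r` with
centres at distance at most `r` are close. -/
theorem enorm_sub_le_of_setLIntegral_ball {n : ℕ} {F : EuclideanSpace ℝ (Fin n) → ℝ}
    (hF : AEStronglyMeasurable F volume) {x y : EuclideanSpace ℝ (Fin n)} {r : ℝ} (hr : 0 < r)
    (hxy : dist x y ≤ r) {a b : ℝ} {Kx Ky : ℝ≥0∞}
    (hx : ∫⁻ z in ball x r, ‖F z - a‖ₑ ≤ Kx * volume (ball x r))
    (hy : ∫⁻ z in ball y r, ‖F z - b‖ₑ ≤ Ky * volume (ball y r)) :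
    ‖b - a‖ₑ ≤ 2 ^ n * (Kx + Ky) := by
  set w := midpoint ℝ x y
  have hwx : ball w (r / 2) ⊆ ball x r := ball_subset_ball' (by
    rw [dist_midpoint_left, Real.norm_ofNat]; linarith)
  have hwy : ball w (r / 2) ⊆ ball y r := ball_subset_ball' (by
    rw [dist_midpoint_right, Real.norm_ofNat]; linarith)
  have hvol : ∀ p : EuclideanSpace ℝ (Fin n),
      volume (ball p r) = 2 ^ n * volume (ball w (r / 2)) := fun p => by
    rw [Measure.addHaar_ball_center, ← Measure.addHaar_ball_center volume w,
      show r = 2 * (r / 2) by ring, volume_ball_mul w two_pos]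
    simp
  have hpos : volume (ball w (r / 2)) ≠ 0 := (measure_ball_pos _ _ (by positivity)).ne'
  rw [← ENNReal.mul_le_mul_iff_left hpos measure_ball_lt_top.ne]
  calc ‖b - a‖ₑ * volume (ball w (r / 2))
      = ∫⁻ _ in ball w (r / 2), ‖b - a‖ₑ := (setLIntegral_const _ _).symm
    _ ≤ ∫⁻ z in ball w (r / 2), (‖F z - a‖ₑ + ‖F z - b‖ₑ) := by
        gcongr with z
        rw [show b - a = (F z - a) - (F z - b) by ring]
        exact enorm_sub_le
    _ = (∫⁻ z in ball w (r / 2), ‖F z - a‖ₑ) + ∫⁻ z in ball w (r / 2), ‖F z - b‖ₑ :=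
        lintegral_add_left' (hF.sub aestronglyMeasurable_const).enorm.restrict _
    _ ≤ Kx * volume (ball x r) + Ky * volume (ball y r) :=
        add_le_add ((lintegral_mono_set hwx).trans hx) ((lintegral_mono_set hwy).trans hy)
    _ = 2 ^ n * (Kx + Ky) * volume (ball w (r / 2)) := by
        rw [hvol x, hvol y]
        ring

theorem WeakDerivFamily.setLIntegral_taylorAt_sub_le {n k : ℕ}
    {u : EuclideanSpace ℝ (Fin n) → ℝ} {D : (Fin n → ℕ) → EuclideanSpace ℝ (Fin n) → ℝ}
    (hD : WeakDerivFamily (k + 1) u D)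
    (hint : ∀ α : Fin n → ℕ, (∑ j, α j) ≤ k + 1 → LocallyIntegrable (D α) volume)
    {p y : EuclideanSpace ℝ (Fin n)} {r : ℝ} (hr : 0 < r) (hpy : ‖y - p‖ ≤ r)
    (hp : maxFn (gradmNorm (k + 1) D) p ≠ ∞) :
    ∫⁻ z in ball p r, ‖taylorAt D y (k + 1) z
        - taylorAt (fun α => rep (D α)) y (k + 1) p‖ₑ
      ≤ ENNReal.ofReal r * (4 ^ n * (ENNReal.ofReal
          (n * (Finset.piAntidiag (Finset.univ : Finset (Fin n)) k).card * (3 * r) ^ k)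
        * maxFn (gradmNorm (k + 1) D) p)) * volume (ball p r) := by
  set c := ENNReal.ofReal
    (n * (Finset.piAntidiag (Finset.univ : Finset (Fin n)) k).card * (3 * r) ^ k)
  have hA : ∀ s, 0 < s → s ≤ 2 * r → ∫⁻ z in ball p s, ∑ i, ‖taylorAtDeriv D y k i z‖ₑ
      ≤ c * maxFn (gradmNorm (k + 1) D) p * volume (ball p s) := fun s hs hsr => by
    calc ∫⁻ z in ball p s, ∑ i, ‖taylorAtDeriv D y k i z‖ₑ
        ≤ ∫⁻ z in ball p s, c * ‖gradmNorm (k + 1) D z‖ₑ := by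
          refine setLIntegral_mono' measurableSet_ball fun z hz => ?_
          refine sum_enorm_taylorAtDeriv_le D y z k ?_
          have h1 : ‖p - z‖ < s := by rwa [← dist_eq_norm, dist_comm]
          linarith [norm_sub_le_norm_sub_add_norm_sub y p z]
      _ = c * ∫⁻ z in ball p s, ‖gradmNorm (k + 1) D z‖ₑ :=
          lintegral_const_mul' _ _ ENNReal.ofReal_ne_top
      _ ≤ _ := by
          rw [mul_assoc]
          gcongr
          exact setLIntegral_ball_le_maxFn _ p hs
  have hF := locallyIntegrable_taylorAt (fun α hα => hint α hα) y
  have htop : c * maxFn (gradmNorm (k + 1) D) p ≠ ∞ :=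
    ENNReal.mul_ne_top ENNReal.ofReal_ne_top hp
  obtain ⟨L, hL⟩ := exists_setLIntegral_enorm_sub_le hF
    (fun i => locallyIntegrable_taylorAtDeriv hint y i)
    (fun i => hD.hasWeakPartialDeriv_taylorAt hint y i) (R := 2 * r) (by positivity) htop hA
  have hL' : HasLebesgueValue (taylorAt D y (k + 1)) p L :=
    HasLebesgueValue.of_le hr (ENNReal.mul_ne_top (by simp) htop)
      fun s hs hsr => hL s hs (by linarith)
  have hval := (hD.hasLebesgueValue_taylorAt hint
    (fun α hα => boundedAverages_of_maxFn_ne_top hp hα) y).rep_eq hF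
  rw [← hval, hL'.rep_eq hF]
  exact hL r hr le_rfl

/-- Pointwise Taylor-remainder estimate of Bojarski–Hajłasz type:
`|u(y) - T_x^{m-1}u(y)| ≤ C |x - y|^m (ℳ|∇^m u|(x) + ℳ|∇^m u|(y))`, where all
derivatives are the precise (limsup of averages) representatives, and the maximal
functions take values in `ℝ≥0∞` (so the inequality holds trivially when the right-hand
side is infinite). -/
theorem pointwise_taylor_estimate (n m : ℕ) (hn : 0 < n) (hm : 0 < m) :
    ∃ C : ℝ, 0 < C ∧
      ∀ (u : EuclideanSpace ℝ (Fin n) → ℝ)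
        (D : (Fin n → ℕ) → EuclideanSpace ℝ (Fin n) → ℝ),
        WeakDerivFamily m u D →
        (∀ α : Fin n → ℕ, (∑ j, α j) ≤ m → LocallyIntegrable (D α) volume) →
        ∀ x y : EuclideanSpace ℝ (Fin n), x ≠ y →
          ENNReal.ofReal
              |rep u y - ∑' α : {α : Fin n → ℕ // (∑ j, α j) ≤ m - 1},
                rep (D α.1) x * (∏ i, (y i - x i) ^ (α.1 i))
                  / ∏ i, (Nat.factorial (α.1 i) : ℝ)|
            ≤ ENNReal.ofReal C * ENNReal.ofReal (‖x - y‖ ^ m) *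
              (maxFn (gradmNorm m D) x + maxFn (gradmNorm m D) y) := by
  obtain ⟨k, rfl⟩ : ∃ k, m = k + 1 := ⟨m - 1, by omega⟩
  set N := ((Finset.piAntidiag (Finset.univ : Finset (Fin n)) k).card : ℝ)
  have hN : 0 < N := by
    have h1 : Pi.single ⟨0, hn⟩ k ∈ Finset.piAntidiag (Finset.univ : Finset (Fin n)) k := by
      simp
    exact Nat.cast_pos.2 (Finset.card_pos.2 ⟨_, h1⟩)
  have hn' : (0 : ℝ) < n := by exact_mod_cast hn
  refine ⟨8 ^ n * (n * N * 3 ^ k), by positivity, fun u D hD hint x y hxy => ?_⟩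
  have hr : 0 < ‖x - y‖ := norm_pos_iff.2 (sub_ne_zero.2 hxy)
  set r := ‖x - y‖
  by_cases htop : maxFn (gradmNorm (k + 1) D) x + maxFn (gradmNorm (k + 1) D) y = ∞
  · rw [htop, ENNReal.mul_top]
    · exact le_top
    · rw [← ENNReal.ofReal_mul (by positivity), Ne, ENNReal.ofReal_eq_zero, not_le]
      positivity
  obtain ⟨hx, hy⟩ := ENNReal.add_ne_top.1 htop
  rw [Nat.add_sub_cancel, tsum_eq_taylorAt (fun α => rep (D α)), ← Real.enorm_eq_ofReal_abs,
    show rep u y = taylorAt (fun α => rep (D α)) y (k + 1) y by rw [taylorAt_self, hD.1]]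
  refine (enorm_sub_le_of_setLIntegral_ball
    (locallyIntegrable_taylorAt (fun α hα => hint α hα) y).aestronglyMeasurable hr
    (dist_eq_norm x y).le
    (hD.setLIntegral_taylorAt_sub_le hint hr (norm_sub_rev y x).le hx)
    (hD.setLIntegral_taylorAt_sub_le hint hr (by simpa using hr.le) hy)).trans_eq ?_
  have h2 : (2 : ℝ≥0∞) ^ n = ENNReal.ofReal (2 ^ n) := by simp [ENNReal.ofReal_pow]
  have h4 : (4 : ℝ≥0∞) ^ n = ENNReal.ofReal (4 ^ n) := by simp [ENNReal.ofReal_pow]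
  have hC : 2 ^ n * (ENNReal.ofReal r * (4 ^ n * ENNReal.ofReal (n * N * (3 * r) ^ k)))
      = ENNReal.ofReal (8 ^ n * (n * N * 3 ^ k)) * ENNReal.ofReal (r ^ (k + 1)) := by
    rw [h2, h4, ← ENNReal.ofReal_mul (by positivity), ← ENNReal.ofReal_mul (by positivity),
      ← ENNReal.ofReal_mul (by positivity), ← ENNReal.ofReal_mul (by positivity),
      show (8 : ℝ) = 2 * 4 by norm_num, mul_pow, mul_pow]
    congr 1
    ring
  rw [← hC]
  ring
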